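/- arXiv:math/0303115 — 2 statements merged into one kernel-verified Lean document; each statement's English description precedes it below -/
import Mathlib

section
/- Fix an integer d ≥ 0 and let G_d be the ℂ-linear span of {A(k,l,q) : k ≥ −1, l ≥ 0, k + l = d, q ∈ {0,1}}. Let T : G_d → G_d be the restriction of ad(A(0,0,1)), i.e. T(w) = [A(0,0,1), w]. Then the kernel of T equals the span of {A(k,l,q) : k + l = d, k = l, q ∈ {0,1}}, the image of T equals the span of {A(k,l,q) : k + l = d, k ≠ l, q ∈ {0,1}}, and G_d is the internal direct sum of ker T and im T. -/
open MvPolynomial in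
/-- The derivation `A_{k+l}^{k-l,q} = i^q (x^{k+1} y^l ∂_x + i^{2q} x^l y^{k+1} ∂_y)`
on `ℂ[x,y]`, determined by `A(k,l,q)(x) = i^q x^{k+1} y^l` and
`A(k,l,q)(y) = i^{3q} x^l y^{k+1}`. -/
noncomputable def anharmonicA (k l q : ℤ) :
    Derivation ℂ (MvPolynomial (Fin 2) ℂ) (MvPolynomial (Fin 2) ℂ) :=
  MvPolynomial.mkDerivation ℂ (fun j : Fin 2 =>
    if j = 0 then Complex.I ^ q • (X 0 ^ (k + 1).toNat * X 1 ^ l.toNat)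
    else Complex.I ^ (3 * q) • (X 0 ^ l.toNat * X 1 ^ (k + 1).toNat))

/-- If a linear endomorphism kills `D` and maps a finite-dimensional `O` onto itself, then `D` and
`O` are its kernel and image on `D ⊔ O`, and they are disjoint. -/
theorem ker_map_of_le_ker_of_map_eq {K V : Type*} [Field K] [AddCommGroup V] [Module K V]
    (T : V →ₗ[K] V) (D O : Submodule K V) [FiniteDimensional K O]
    (hD : D ≤ LinearMap.ker T) (hO : O.map T = O) :
    (D ⊔ O) ⊓ LinearMap.ker T = D ∧ (D ⊔ O).map T = O ∧ D ⊓ O = ⊥ := by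
  have hmem : ∀ x ∈ O, T x ∈ O := fun x hx => hO.le (Submodule.mem_map_of_mem hx)
  have hsurj : Function.Surjective (T.restrict hmem) := by
    rintro ⟨y, hy⟩
    obtain ⟨x, hx, rfl⟩ := hO.ge hy
    exact ⟨⟨x, hx⟩, rfl⟩
  have hinj := LinearMap.injective_iff_surjective.mpr hsurj
  have hzero : ∀ x ∈ O, T x = 0 → x = 0 := fun x hx h =>
    congrArg Subtype.val (@hinj ⟨x, hx⟩ 0 (Subtype.ext (by simpa using h)))
  refine ⟨le_antisymm ?_ (le_inf le_sup_left hD), ?_, ?_⟩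
  · rintro w ⟨hw, hTw⟩
    obtain ⟨a, ha, b, hb, rfl⟩ := Submodule.mem_sup.mp hw
    have hTa : T a = 0 := hD ha
    have hTb : T b = 0 := by simpa [hTa] using hTw
    simpa [hzero b hb hTb] using ha
  · rw [Submodule.map_sup, hO, LinearMap.le_ker_iff_map.mp hD, bot_sup_eq]
  · exact (Submodule.eq_bot_iff _).mpr fun x hx => hzero x hx.2 (hD hx.1)

theorem anharmonicA_X_zero (k l q : ℤ) :
    anharmonicA k l q (MvPolynomial.X 0) = Complex.I ^ q •
      (MvPolynomial.X 0 ^ (k + 1).toNat * MvPolynomial.X 1 ^ l.toNat) := by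
  simp [anharmonicA, MvPolynomial.mkDerivation_X]

theorem anharmonicA_X_one (k l q : ℤ) :
    anharmonicA k l q (MvPolynomial.X 1) = Complex.I ^ (3 * q) •
      (MvPolynomial.X 0 ^ l.toNat * MvPolynomial.X 1 ^ (k + 1).toNat) := by
  simp [anharmonicA, MvPolynomial.mkDerivation_X]

/-- An eigenvector of a derivation has its powers as eigenvectors. -/
theorem Derivation.apply_pow_of_apply_eq_smul {K R : Type*} [CommRing K] [CommRing R] [Algebra K R]
    (D : Derivation K R R) {x : R} {c : K} (h : D x = c • x) (n : ℕ) :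
    D (x ^ n) = (n * c) • x ^ n := by
  induction n with
  | zero => simp
  | succ n ih =>
    rw [pow_succ, D.leibniz, ih, h]
    simp only [smul_eq_mul, Algebra.smul_def, map_mul, Nat.cast_succ, map_add, map_one]
    ring

theorem anharmonicA_zero_zero_one_X_zero :
    anharmonicA 0 0 1 (MvPolynomial.X 0) = Complex.I • MvPolynomial.X 0 := by
  simp [anharmonicA_X_zero]

theorem anharmonicA_zero_zero_one_X_one :
    anharmonicA 0 0 1 (MvPolynomial.X 1) = (-Complex.I) • MvPolynomial.X 1 := by
  have h : Complex.I ^ (3 : ℤ) = -Complex.I := by exact_mod_cast Complex.I_pow_three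
  simp [anharmonicA_X_one, h]

theorem anharmonicA_zero_zero_one_monomial (a b : ℕ) :
    anharmonicA 0 0 1 (MvPolynomial.X 0 ^ a * MvPolynomial.X 1 ^ b) =
      (((a : ℂ) - b) * Complex.I) • (MvPolynomial.X 0 ^ a * MvPolynomial.X 1 ^ b) := by
  rw [Derivation.leibniz,
    Derivation.apply_pow_of_apply_eq_smul _ anharmonicA_zero_zero_one_X_zero,
    Derivation.apply_pow_of_apply_eq_smul _ anharmonicA_zero_zero_one_X_one]
  simp only [smul_eq_mul, Algebra.smul_def, map_mul, map_sub, map_neg]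
  ring

theorem bracket_anharmonicA (k l q : ℤ) (hk : -1 ≤ k) (hl : 0 ≤ l) :
    ⁅anharmonicA 0 0 1, anharmonicA k l q⁆ = ((k : ℂ) - l) • anharmonicA k l (q + 1) := by
  have ha : (((k + 1).toNat : ℕ) : ℂ) = k + 1 := by
    exact_mod_cast congrArg (Int.cast : ℤ → ℂ) (Int.toNat_of_nonneg (by omega : 0 ≤ k + 1))
  have hb : ((l.toNat : ℕ) : ℂ) = l := by
    exact_mod_cast congrArg (Int.cast : ℤ → ℂ) (Int.toNat_of_nonneg hl)
  have h3 : Complex.I ^ (3 * (q + 1)) = -(Complex.I ^ (3 * q) * Complex.I) := by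
    rw [mul_add, mul_one, zpow_add₀ Complex.I_ne_zero,
      show Complex.I ^ (3 : ℤ) = -Complex.I by exact_mod_cast Complex.I_pow_three, mul_neg]
  refine MvPolynomial.derivation_ext fun j => ?_
  fin_cases j
  · simp only [Fin.zero_eta, Derivation.commutator_apply, Derivation.smul_apply,
      anharmonicA_zero_zero_one_X_zero, Derivation.map_smul, anharmonicA_X_zero k,
      anharmonicA_zero_zero_one_monomial, smul_smul, ← sub_smul, ha, hb,
      zpow_add_one₀ Complex.I_ne_zero]
    congr 1
    ring
  · simp only [Fin.mk_one, Derivation.commutator_apply, Derivation.smul_apply,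
      anharmonicA_zero_zero_one_X_one, Derivation.map_smul, anharmonicA_X_one k,
      anharmonicA_zero_zero_one_monomial, smul_smul, ← sub_smul, ha, hb, h3]
    congr 1
    ring

theorem anharmonicA_two (k l : ℤ) : anharmonicA k l 2 = -anharmonicA k l 0 := by
  have h2 : Complex.I ^ (2 : ℤ) = -1 := by exact_mod_cast Complex.I_sq
  have h6 : Complex.I ^ (3 * 2 : ℤ) = -1 := by
    rw [mul_comm, zpow_mul, h2]
    norm_num
  refine MvPolynomial.derivation_ext fun j => ?_
  fin_cases j
  · simp [anharmonicA_X_zero, h2]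
  · simp only [Fin.mk_one, Derivation.neg_apply, anharmonicA_X_one, h6]
    simp

/-- On the degree-`d` part `G_d`, the restriction `T` of `ad(A(0,0,1))` has kernel spanned
by the diagonal elements, image spanned by the off-diagonal elements, and `G_d` is the
internal direct sum of `ker T` and `im T`. -/
theorem stmt_15 (d : ℤ) (hd : 0 ≤ d)
    (T : Derivation ℂ (MvPolynomial (Fin 2) ℂ) (MvPolynomial (Fin 2) ℂ) →ₗ[ℂ]
      Derivation ℂ (MvPolynomial (Fin 2) ℂ) (MvPolynomial (Fin 2) ℂ))
    (hT : ∀ w, T w = ⁅anharmonicA 0 0 1, w⁆) :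
    (∀ w ∈ Submodule.span ℂ
        {w : Derivation ℂ (MvPolynomial (Fin 2) ℂ) (MvPolynomial (Fin 2) ℂ) |
          ∃ k l q : ℤ, -1 ≤ k ∧ 0 ≤ l ∧ k + l = d ∧ (q = 0 ∨ q = 1) ∧ w = anharmonicA k l q},
      T w ∈ Submodule.span ℂ
        {w : Derivation ℂ (MvPolynomial (Fin 2) ℂ) (MvPolynomial (Fin 2) ℂ) |
          ∃ k l q : ℤ, -1 ≤ k ∧ 0 ≤ l ∧ k + l = d ∧ (q = 0 ∨ q = 1) ∧ w = anharmonicA k l q}) ∧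
    (Submodule.span ℂ
        {w : Derivation ℂ (MvPolynomial (Fin 2) ℂ) (MvPolynomial (Fin 2) ℂ) |
          ∃ k l q : ℤ, -1 ≤ k ∧ 0 ≤ l ∧ k + l = d ∧ (q = 0 ∨ q = 1) ∧ w = anharmonicA k l q} ⊓
        LinearMap.ker T =
      Submodule.span ℂ
        {w : Derivation ℂ (MvPolynomial (Fin 2) ℂ) (MvPolynomial (Fin 2) ℂ) |
          ∃ k l q : ℤ, -1 ≤ k ∧ 0 ≤ l ∧ k + l = d ∧ k = l ∧ (q = 0 ∨ q = 1) ∧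
            w = anharmonicA k l q}) ∧
    ((Submodule.span ℂ
        {w : Derivation ℂ (MvPolynomial (Fin 2) ℂ) (MvPolynomial (Fin 2) ℂ) |
          ∃ k l q : ℤ, -1 ≤ k ∧ 0 ≤ l ∧ k + l = d ∧ (q = 0 ∨ q = 1) ∧
            w = anharmonicA k l q}).map T =
      Submodule.span ℂ
        {w : Derivation ℂ (MvPolynomial (Fin 2) ℂ) (MvPolynomial (Fin 2) ℂ) |
          ∃ k l q : ℤ, -1 ≤ k ∧ 0 ≤ l ∧ k + l = d ∧ k ≠ l ∧ (q = 0 ∨ q = 1) ∧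
            w = anharmonicA k l q}) ∧
    ((Submodule.span ℂ
        {w : Derivation ℂ (MvPolynomial (Fin 2) ℂ) (MvPolynomial (Fin 2) ℂ) |
          ∃ k l q : ℤ, -1 ≤ k ∧ 0 ≤ l ∧ k + l = d ∧ (q = 0 ∨ q = 1) ∧
            w = anharmonicA k l q} ⊓ LinearMap.ker T) ⊔
        (Submodule.span ℂ
          {w : Derivation ℂ (MvPolynomial (Fin 2) ℂ) (MvPolynomial (Fin 2) ℂ) |
            ∃ k l q : ℤ, -1 ≤ k ∧ 0 ≤ l ∧ k + l = d ∧ (q = 0 ∨ q = 1) ∧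
              w = anharmonicA k l q}).map T =
      Submodule.span ℂ
        {w : Derivation ℂ (MvPolynomial (Fin 2) ℂ) (MvPolynomial (Fin 2) ℂ) |
          ∃ k l q : ℤ, -1 ≤ k ∧ 0 ≤ l ∧ k + l = d ∧ (q = 0 ∨ q = 1) ∧
            w = anharmonicA k l q}) ∧
    ((Submodule.span ℂ
        {w : Derivation ℂ (MvPolynomial (Fin 2) ℂ) (MvPolynomial (Fin 2) ℂ) |
          ∃ k l q : ℤ, -1 ≤ k ∧ 0 ≤ l ∧ k + l = d ∧ (q = 0 ∨ q = 1) ∧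
            w = anharmonicA k l q} ⊓ LinearMap.ker T) ⊓
        (Submodule.span ℂ
          {w : Derivation ℂ (MvPolynomial (Fin 2) ℂ) (MvPolynomial (Fin 2) ℂ) |
            ∃ k l q : ℤ, -1 ≤ k ∧ 0 ≤ l ∧ k + l = d ∧ (q = 0 ∨ q = 1) ∧
              w = anharmonicA k l q}).map T = ⊥) := by
  set G : Set (Derivation ℂ (MvPolynomial (Fin 2) ℂ) (MvPolynomial (Fin 2) ℂ)) :=
    {w | ∃ k l q : ℤ, -1 ≤ k ∧ 0 ≤ l ∧ k + l = d ∧ (q = 0 ∨ q = 1) ∧ w = anharmonicA k l q}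
  set D : Set (Derivation ℂ (MvPolynomial (Fin 2) ℂ) (MvPolynomial (Fin 2) ℂ)) :=
    {w | ∃ k l q : ℤ, -1 ≤ k ∧ 0 ≤ l ∧ k + l = d ∧ k = l ∧ (q = 0 ∨ q = 1) ∧
      w = anharmonicA k l q}
  set O : Set (Derivation ℂ (MvPolynomial (Fin 2) ℂ) (MvPolynomial (Fin 2) ℂ)) :=
    {w | ∃ k l q : ℤ, -1 ≤ k ∧ 0 ≤ l ∧ k + l = d ∧ k ≠ l ∧ (q = 0 ∨ q = 1) ∧
      w = anharmonicA k l q}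
  have hGDO : Submodule.span ℂ G = Submodule.span ℂ D ⊔ Submodule.span ℂ O := by
    rw [← Submodule.span_union]
    congr 1
    ext w
    constructor
    · rintro ⟨k, l, q, hk, hl, hkl, hq, rfl⟩
      by_cases h : k = l
      · exact Or.inl ⟨k, l, q, hk, hl, hkl, h, hq, rfl⟩
      · exact Or.inr ⟨k, l, q, hk, hl, hkl, h, hq, rfl⟩
    · rintro (⟨k, l, q, hk, hl, hkl, -, hq, rfl⟩ | ⟨k, l, q, hk, hl, hkl, -, hq, rfl⟩) <;>
        exact ⟨k, l, q, hk, hl, hkl, hq, rfl⟩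
  have hOfin : O.Finite := by
    refine (((Set.finite_Icc (-1) d).prod (Set.finite_Icc (0 : ℤ) 1)).image
      fun p : ℤ × ℤ => anharmonicA p.1 (d - p.1) p.2).subset ?_
    rintro w ⟨k, l, q, hk, hl, hkl, -, hq, rfl⟩
    refine ⟨(k, q), ⟨⟨hk, by omega⟩, ?_, ?_⟩, ?_⟩
    · rcases hq with rfl | rfl <;> simp
    · rcases hq with rfl | rfl <;> simp
    · simp [← hkl]
  have : FiniteDimensional ℂ (Submodule.span ℂ O) := FiniteDimensional.span_of_finite ℂ hOfin
  have hker : Submodule.span ℂ D ≤ LinearMap.ker T := by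
    rw [Submodule.span_le]
    rintro w ⟨k, l, q, hk, hl, -, rfl, -, rfl⟩
    simp [hT, bracket_anharmonicA k k q hk hl]
  have hmap : (Submodule.span ℂ O).map T = Submodule.span ℂ O := by
    apply le_antisymm
    · rw [Submodule.map_span_le]
      rintro w ⟨k, l, q, hk, hl, hkl, hne, hq, rfl⟩
      rw [hT, bracket_anharmonicA k l q hk hl]
      apply Submodule.smul_mem
      rcases hq with rfl | rfl
      · exact Submodule.subset_span ⟨k, l, 1, hk, hl, hkl, hne, Or.inr rfl, rfl⟩
      · rw [one_add_one_eq_two, anharmonicA_two]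
        exact Submodule.neg_mem _
          (Submodule.subset_span ⟨k, l, 0, hk, hl, hkl, hne, Or.inl rfl, rfl⟩)
    · rw [Submodule.span_le]
      rintro w ⟨k, l, q, hk, hl, hkl, hne, hq, rfl⟩
      have hc : (k : ℂ) - l ≠ 0 := sub_ne_zero.mpr (by exact_mod_cast hne)
      rcases hq with rfl | rfl
      · refine ⟨(-((k : ℂ) - l)⁻¹) • anharmonicA k l 1, Submodule.smul_mem _ _
          (Submodule.subset_span ⟨k, l, 1, hk, hl, hkl, hne, Or.inr rfl, rfl⟩), ?_⟩
        rw [map_smul, hT, bracket_anharmonicA k l 1 hk hl, one_add_one_eq_two, anharmonicA_two,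
          smul_smul, neg_mul, inv_mul_cancel₀ hc, neg_one_smul, neg_neg]
      · refine ⟨((k : ℂ) - l)⁻¹ • anharmonicA k l 0, Submodule.smul_mem _ _
          (Submodule.subset_span ⟨k, l, 0, hk, hl, hkl, hne, Or.inl rfl, rfl⟩), ?_⟩
        rw [map_smul, hT, bracket_anharmonicA k l 0 hk hl, zero_add, smul_smul,
          inv_mul_cancel₀ hc, one_smul]
  obtain ⟨hkerG, hmapG, hdisj⟩ := ker_map_of_le_ker_of_map_eq T _ _ hker hmap
  rw [hGDO, hkerG, hmapG]
  exact ⟨fun w hw => Submodule.mem_sup_right (hmapG.le (Submodule.mem_map_of_mem hw)),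
    rfl, rfl, rfl, hdisj⟩
end

section
/- Fix an integer q ≥ 1 and let L_0 be the ℂ-linear span of {A(p,p,0) : p ∈ ℕ} and L_1 the ℂ-linear span of {A(p,p,1) : p ∈ ℕ}. Let S denote the map w ↦ [A(q,q,0), w]. Then S maps L_0 into L_0 and L_1 into L_1; the kernel of S restricted to L_0 is the span of A(q,q,0) and its image is the span of {A(s,s,0) : s ≥ q, s ≠ 2q}; the kernel of S restricted to L_1 is the span of A(0,0,1) and its image is the span of {A(s,s,1) : s ≥ q + 1}. -/
open MvPolynomial in
theorem anharmonicA_apply_X_zero (p : ℕ) (r : ℤ) :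
    anharmonicA p p r (X 0) = Complex.I ^ r • (X 0 ^ (p + 1) * X 1 ^ p) := by
  simp only [anharmonicA, mkDerivation_X, if_true, Int.toNat_natCast, Int.toNat_natCast_add_one]

open MvPolynomial in
theorem anharmonicA_apply_X_one (p : ℕ) (r : ℤ) :
    anharmonicA p p r (X 1) = Complex.I ^ (3 * r) • (X 0 ^ p * X 1 ^ (p + 1)) := by
  simp only [anharmonicA, mkDerivation_X, one_ne_zero, if_false, Int.toNat_natCast,
    Int.toNat_natCast_add_one]

open MvPolynomial in
theorem anharmonicA_zero_lie_zero (n p : ℕ) :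
    ⁅anharmonicA n n 0, anharmonicA p p 0⁆ =
      (2 * ((p : ℂ) - n)) • anharmonicA (p + n : ℕ) (p + n : ℕ) 0 := by
  refine MvPolynomial.derivation_ext fun j => ?_
  fin_cases j <;>
  · simp only [Fin.zero_eta, Fin.mk_one, Derivation.commutator_apply, Derivation.smul_apply,
      anharmonicA_apply_X_zero, anharmonicA_apply_X_one, Derivation.leibniz,
      Derivation.leibniz_pow, smul_eq_mul, nsmul_eq_mul, zpow_zero, mul_zero, one_smul,
      MvPolynomial.smul_eq_C_mul, map_mul, map_sub, map_natCast, map_ofNat]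
    rcases n with _ | n <;> rcases p with _ | p <;>
      simp only [Nat.add_sub_cancel, Nat.cast_zero, Nat.cast_succ, zero_mul] <;> ring

open MvPolynomial in
theorem anharmonicA_zero_lie_one (n p : ℕ) :
    ⁅anharmonicA n n 0, anharmonicA p p 1⁆ =
      (2 * (p : ℂ)) • anharmonicA (p + n : ℕ) (p + n : ℕ) 1 := by
  have hI : (Complex.I ^ (3 * 1 : ℤ)) = -Complex.I := by
    rw [mul_one]; exact_mod_cast Complex.I_pow_three
  refine MvPolynomial.derivation_ext fun j => ?_
  fin_cases j <;>
  · simp only [Fin.zero_eta, Fin.mk_one, Derivation.commutator_apply, Derivation.smul_apply,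
      anharmonicA_apply_X_zero, anharmonicA_apply_X_one, Derivation.leibniz,
      Derivation.leibniz_pow, smul_eq_mul, nsmul_eq_mul, zpow_zero, mul_zero, one_smul, hI,
      zpow_one, map_neg, derivation_C, MvPolynomial.smul_eq_C_mul, map_mul, map_natCast, map_ofNat]
    rcases n with _ | n <;> rcases p with _ | p <;>
      simp only [Nat.add_sub_cancel, Nat.cast_zero, Nat.cast_succ, zero_mul] <;> ring

open MvPolynomial in
theorem linearIndependent_anharmonicA (r : ℤ) :
    LinearIndependent ℂ fun p : ℕ => anharmonicA p p r := by
  let e : ℕ → Fin 2 →₀ ℕ := fun p => Finsupp.single 0 (p + 1) + Finsupp.single 1 p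
  have he : Function.Injective e := fun a b hab => by
    simpa [e] using DFunLike.congr_fun hab 1
  let evalX : Derivation ℂ (MvPolynomial (Fin 2) ℂ) (MvPolynomial (Fin 2) ℂ) →ₗ[ℂ]
      MvPolynomial (Fin 2) ℂ :=
    { toFun := fun D => D (X 0)
      map_add' := fun _ _ => rfl
      map_smul' := fun _ _ => rfl }
  refine LinearIndependent.of_comp evalX ?_
  let u : ℂˣ := Units.mk0 (Complex.I ^ r) (zpow_ne_zero r Complex.I_ne_zero)
  suffices hcomp : (evalX ∘ fun p : ℕ => anharmonicA p p r) =
      (fun _ : ℕ => u) • (basisMonomials (Fin 2) ℂ ∘ e) by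
    rw [hcomp]
    exact ((basisMonomials (Fin 2) ℂ).linearIndependent.comp e he).units_smul fun _ => u
  funext p
  simp only [Function.comp_apply, Pi.smul_apply', coe_basisMonomials, Units.smul_mk0, u, e, evalX,
    LinearMap.coe_mk, AddHom.coe_mk, anharmonicA_apply_X_zero, X_pow_eq_monomial, monomial_mul,
    mul_one]

section WeightedShift

variable {K V : Type*} [Field K] [AddCommGroup V] [Module K V] {v : ℕ → V} {c : ℕ → K} {n m : ℕ}
  {S : V →ₗ[K] V}

theorem map_mem_span_range_of_weighted_shift (hS : ∀ p, S (v p) = c p • v (p + n)) :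
    ∀ w ∈ Submodule.span K (Set.range v), S w ∈ Submodule.span K (Set.range v) := by
  intro w hw
  have hle : Submodule.span K (Set.range v) ≤ (Submodule.span K (Set.range v)).comap S := by
    rw [Submodule.span_le]
    rintro _ ⟨p, rfl⟩
    rw [SetLike.mem_coe, Submodule.mem_comap, hS]
    exact Submodule.smul_mem _ _ (Submodule.subset_span ⟨_, rfl⟩)
  exact hle hw

theorem span_range_inf_ker_of_weighted_shift (hv : LinearIndependent K v)
    (hS : ∀ p, S (v p) = c p • v (p + n)) (hc : ∀ p, c p = 0 ↔ p = m) :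
    Submodule.span K (Set.range v) ⊓ LinearMap.ker S = Submodule.span K {v m} := by
  apply le_antisymm
  · rintro w ⟨hw, hker⟩
    obtain ⟨f, rfl⟩ := (Finsupp.mem_span_range_iff_exists_finsupp).1 hw
    have hsum : ∑ p ∈ f.support, (f p * c p) • v (p + n) = 0 := by
      have hker' : S (f.sum fun p a => a • v p) = 0 := hker
      simpa only [Finsupp.sum, map_sum, map_smul, hS, smul_smul] using hker'
    have hzero := linearIndependent_iff'.1 (hv.comp (· + n) (add_left_injective n)) _ _ hsum
    refine Submodule.sum_mem _ fun p hp => ?_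
    have hpm : p = m :=
      (hc p).1 ((mul_eq_zero.1 (hzero p hp)).resolve_left (Finsupp.mem_support_iff.1 hp))
    subst hpm
    exact Submodule.smul_mem _ _ (Submodule.mem_span_singleton_self _)
  · rw [Submodule.span_singleton_le_iff_mem]
    refine ⟨Submodule.subset_span ⟨m, rfl⟩, ?_⟩
    rw [SetLike.mem_coe, LinearMap.mem_ker, hS, (hc m).2 rfl, zero_smul]

theorem map_span_range_of_weighted_shift (hS : ∀ p, S (v p) = c p • v (p + n))
    (hc : ∀ p, c p = 0 ↔ p = m) :
    (Submodule.span K (Set.range v)).map S =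
      Submodule.span K {w | ∃ p, p ≠ m ∧ w = v (p + n)} := by
  rw [Submodule.map_span]
  apply le_antisymm <;> rw [Submodule.span_le]
  · rintro _ ⟨_, ⟨p, rfl⟩, rfl⟩
    rw [SetLike.mem_coe, hS]
    by_cases hp : p = m
    · rw [(hc p).2 hp, zero_smul]
      exact Submodule.zero_mem _
    · exact Submodule.smul_mem _ _ (Submodule.subset_span ⟨p, hp, rfl⟩)
  · rintro _ ⟨p, hp, rfl⟩
    have hcp : c p ≠ 0 := fun h => hp ((hc p).1 h)
    have hvp : v (p + n) = (c p)⁻¹ • S (v p) := by rw [hS, inv_smul_smul₀ hcp]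
    rw [hvp]
    exact Submodule.smul_mem _ _ (Submodule.subset_span ⟨_, ⟨p, rfl⟩, rfl⟩)

end WeightedShift

/-- The action of `S = ad(A(q,q,0))` on the spans `L₀ = ⟨A(p,p,0)⟩` and `L₁ = ⟨A(p,p,1)⟩`:
it preserves both, with kernels `⟨A(q,q,0)⟩` resp. `⟨A(0,0,1)⟩` and images
`⟨A(s,s,0) : s ≥ q, s ≠ 2q⟩` resp. `⟨A(s,s,1) : s ≥ q+1⟩`. -/
theorem stmt_16 (q : ℤ) (hq : 1 ≤ q)
    (S : Derivation ℂ (MvPolynomial (Fin 2) ℂ) (MvPolynomial (Fin 2) ℂ) →ₗ[ℂ]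
      Derivation ℂ (MvPolynomial (Fin 2) ℂ) (MvPolynomial (Fin 2) ℂ))
    (hS : ∀ w, S w = ⁅anharmonicA q q 0, w⁆) :
    (∀ w ∈ Submodule.span ℂ
        {w : Derivation ℂ (MvPolynomial (Fin 2) ℂ) (MvPolynomial (Fin 2) ℂ) |
          ∃ p : ℕ, w = anharmonicA p p 0},
      S w ∈ Submodule.span ℂ
        {w : Derivation ℂ (MvPolynomial (Fin 2) ℂ) (MvPolynomial (Fin 2) ℂ) |
          ∃ p : ℕ, w = anharmonicA p p 0}) ∧
    (∀ w ∈ Submodule.span ℂ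
        {w : Derivation ℂ (MvPolynomial (Fin 2) ℂ) (MvPolynomial (Fin 2) ℂ) |
          ∃ p : ℕ, w = anharmonicA p p 1},
      S w ∈ Submodule.span ℂ
        {w : Derivation ℂ (MvPolynomial (Fin 2) ℂ) (MvPolynomial (Fin 2) ℂ) |
          ∃ p : ℕ, w = anharmonicA p p 1}) ∧
    (Submodule.span ℂ
        {w : Derivation ℂ (MvPolynomial (Fin 2) ℂ) (MvPolynomial (Fin 2) ℂ) |
          ∃ p : ℕ, w = anharmonicA p p 0} ⊓ LinearMap.ker S =
      Submodule.span ℂ {anharmonicA q q 0}) ∧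
    ((Submodule.span ℂ
        {w : Derivation ℂ (MvPolynomial (Fin 2) ℂ) (MvPolynomial (Fin 2) ℂ) |
          ∃ p : ℕ, w = anharmonicA p p 0}).map S =
      Submodule.span ℂ
        {w : Derivation ℂ (MvPolynomial (Fin 2) ℂ) (MvPolynomial (Fin 2) ℂ) |
          ∃ s : ℤ, q ≤ s ∧ s ≠ 2 * q ∧ w = anharmonicA s s 0}) ∧
    (Submodule.span ℂ
        {w : Derivation ℂ (MvPolynomial (Fin 2) ℂ) (MvPolynomial (Fin 2) ℂ) |
          ∃ p : ℕ, w = anharmonicA p p 1} ⊓ LinearMap.ker S =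
      Submodule.span ℂ {anharmonicA 0 0 1}) ∧
    ((Submodule.span ℂ
        {w : Derivation ℂ (MvPolynomial (Fin 2) ℂ) (MvPolynomial (Fin 2) ℂ) |
          ∃ p : ℕ, w = anharmonicA p p 1}).map S =
      Submodule.span ℂ
        {w : Derivation ℂ (MvPolynomial (Fin 2) ℂ) (MvPolynomial (Fin 2) ℂ) |
          ∃ s : ℤ, q + 1 ≤ s ∧ w = anharmonicA s s 1}) := by
  lift q to ℕ using by omega with n
  have hrange (r : ℤ) :
      {w : Derivation ℂ (MvPolynomial (Fin 2) ℂ) (MvPolynomial (Fin 2) ℂ) |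
        ∃ p : ℕ, w = anharmonicA p p r} = Set.range fun p : ℕ => anharmonicA p p r := by
    ext w
    exact exists_congr fun p => eq_comm
  have hS₀ (p : ℕ) : S (anharmonicA p p 0) =
      (2 * ((p : ℂ) - n)) • anharmonicA (p + n : ℕ) (p + n : ℕ) 0 := by
    rw [hS, anharmonicA_zero_lie_zero]
  have hS₁ (p : ℕ) : S (anharmonicA p p 1) =
      (2 * (p : ℂ)) • anharmonicA (p + n : ℕ) (p + n : ℕ) 1 := by
    rw [hS, anharmonicA_zero_lie_one]
  have hc₀ (p : ℕ) : 2 * ((p : ℂ) - n) = 0 ↔ p = n := by simp [sub_eq_zero]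
  have hc₁ (p : ℕ) : 2 * (p : ℂ) = 0 ↔ p = 0 := by simp
  rw [hrange 0, hrange 1]
  refine ⟨map_mem_span_range_of_weighted_shift hS₀, map_mem_span_range_of_weighted_shift hS₁,
    span_range_inf_ker_of_weighted_shift (linearIndependent_anharmonicA 0) hS₀ hc₀, ?_,
    span_range_inf_ker_of_weighted_shift (linearIndependent_anharmonicA 1) hS₁ hc₁, ?_⟩
  · rw [map_span_range_of_weighted_shift hS₀ hc₀]
    congr 1
    ext w
    constructor
    · rintro ⟨p, hp, rfl⟩
      exact ⟨(p + n : ℕ), by omega, by omega, rfl⟩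
    · rintro ⟨s, hs, hs', rfl⟩
      obtain ⟨p, rfl⟩ := Int.le.dest hs
      exact ⟨p, by omega, by push_cast; rw [add_comm]⟩
  · rw [map_span_range_of_weighted_shift hS₁ hc₁]
    congr 1
    ext w
    constructor
    · rintro ⟨p, hp, rfl⟩
      exact ⟨(p + n : ℕ), by omega, rfl⟩
    · rintro ⟨s, hs, rfl⟩
      obtain ⟨p, rfl⟩ := Int.le.dest (show (n : ℤ) ≤ s by omega)
      exact ⟨p, by omega, by push_cast; rw [add_comm]⟩
end
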